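/- Let s be a positive integer. If n₁, n₂ are relatively prime integers ≥ 2 with L(e^{1/s}, 1/n₁) = 0 and L(e^{1/s}, 1/n₂) = 0, then L(e^{1/s}, 1/(n₁n₂)) = 0. -/

import Mathlib

/-- Distance from a real number to the nearest integer. -/
noncomputable def distNearestInt (x : ℝ) : ℝ := |x - round x|

/-- The inhomogeneous approximation constant. -/
noncomputable def Lconst (θ φ : ℝ) : ℝ :=
  Filter.liminf (fun q : ℤ => |(q : ℝ)| * distNearestInt (q * θ - φ)) Filter.cofinite

/-- The sequence `1, 2s + a, …` with `xⱼ₊₁ = 2s(2j + 1)xⱼ + xⱼ₋₁`. For `a = 1` and `a = -1` its terms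
are the numerators and denominators of the leapers of `e^{1/s}`. -/
def leaper (s : ℕ) (a : ℤ) : ℕ → ℤ
  | 0 => 1
  | 1 => 2 * s + a
  | j + 2 => 2 * s * (2 * j + 3) * leaper s a (j + 1) + leaper s a j

theorem leaper_add_two (s : ℕ) (a : ℤ) (j : ℕ) :
    leaper s a (j + 2) = 2 * s * (2 * j + 3) * leaper s a (j + 1) + leaper s a j := rfl

theorem leaper_det (s j : ℕ) :
    leaper s 1 (j + 1) * leaper s (-1) j - leaper s 1 j * leaper s (-1) (j + 1) =
      (-1) ^ j * 2 := by
  induction j with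
  | zero => simp [leaper]
  | succ j ih =>
    rw [leaper_add_two, leaper_add_two, pow_succ]
    linear_combination -ih

theorem odd_leaper (s : ℕ) {a : ℤ} (ha : Odd a) (j : ℕ) : Odd (leaper s a j) := by
  induction j using Nat.twoStepInduction with
  | zero => exact odd_one
  | one => exact (even_two_mul _).add_odd ha
  | more j ih _ =>
    rw [leaper_add_two, mul_assoc, mul_assoc]
    exact (even_two_mul _).add_odd ih

theorem one_le_leaper {s : ℕ} (hs : 1 ≤ s) (j : ℕ) :
    1 ≤ leaper s (-1) j := by
  have hs' : (1 : ℤ) ≤ s := by exact_mod_cast hs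
  induction j using Nat.twoStepInduction with
  | zero => exact le_rfl
  | one => simp only [leaper]; linarith
  | more j ih₀ ih₁ =>
    rw [leaper_add_two]
    have : 0 ≤ 2 * (s : ℤ) * (2 * j + 3) * leaper s (-1) (j + 1) := by positivity
    linarith

theorem leaper_mul_le {s : ℕ} (hs : 1 ≤ s) (j : ℕ) :
    (2 * j + 1) * leaper s (-1) j ≤ leaper s (-1) (j + 1) := by
  have hs' : (1 : ℤ) ≤ s := by exact_mod_cast hs
  cases j with
  | zero => simp only [leaper]; push_cast; linarith
  | succ j =>
    rw [leaper_add_two]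
    have h₀ := one_le_leaper hs j
    have h₁ := one_le_leaper hs (j + 1)
    have : 0 ≤ (2 * (s : ℤ) - 1) * ((2 * j + 3) * leaper s (-1) (j + 1)) :=
      mul_nonneg (by linarith) (by positivity)
    push_cast
    linarith

theorem le_leaper_succ {s : ℕ} (hs : 1 ≤ s) (j : ℕ) : (j : ℤ) ≤ leaper s (-1) (j + 1) := by
  have h₀ := one_le_leaper hs j
  have h₁ := leaper_mul_le hs j
  nlinarith

theorem leaper_le_succ {s : ℕ} (hs : 1 ≤ s) (j : ℕ) :
    leaper s (-1) j ≤ leaper s (-1) (j + 1) := by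
  have h₀ := one_le_leaper hs j
  have h₁ := leaper_mul_le hs j
  nlinarith

theorem leaper_reflect (s k i : ℕ) (hi : i ≤ k) :
    leaper s (-1) (k + i) ≡ leaper s (-1) (k - i) [ZMOD (2 * k + 1 : ℕ)] := by
  induction i using Nat.twoStepInduction with
  | zero => rfl
  | one =>
    obtain ⟨m, rfl⟩ : ∃ m, k = m + 1 := ⟨k - 1, by lia⟩
    rw [leaper_add_two, Nat.add_sub_cancel]
    refine (Int.modEq_iff_dvd.2 ⟨-(2 * s * leaper s (-1) (m + 1)), ?_⟩)
    push_cast; ring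
  | more i ih₀ ih₁ =>
    obtain ⟨m, rfl⟩ : ∃ m, k = m + i + 2 := ⟨k - (i + 2), by lia⟩
    have h₀ := (ih₀ (by lia)).dvd
    have h₁ := (ih₁ (by lia)).dvd
    rw [show m + i + 2 - i = m + 2 by lia] at h₀
    rw [show m + i + 2 - (i + 1) = m + 1 by lia] at h₁
    rw [show m + i + 2 - (i + 2) = m by lia]
    rw [show m + i + 2 + (i + 2) = (m + i + 2 + i) + 2 by lia, leaper_add_two]
    rw [leaper_add_two] at h₀
    obtain ⟨a, ha⟩ := h₀
    obtain ⟨b, hb⟩ := h₁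
    rw [← add_assoc] at hb
    refine Int.modEq_iff_dvd.2 ⟨a + 2 * s * (2 * ↑(m + i + 2 + i) + 3) * b -
      4 * s * leaper s (-1) (m + 1), ?_⟩
    push_cast at *
    linear_combination ha + 2 * s * (2 * (m + i + 2 + i) + 3) * hb

theorem leaper_add_modEq (s : ℕ) {n : ℕ} (hn : Odd n) (hn1 : n ≠ 1) (j : ℕ) :
    leaper s (-1) (j + n) ≡ -leaper s (-1) j [ZMOD n] := by
  obtain ⟨k, rfl⟩ := hn
  obtain ⟨m, rfl⟩ : ∃ m, k = m + 1 := ⟨k - 1, by lia⟩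
  obtain ⟨a, ha⟩ := (leaper_reflect s (m + 1) (m + 1) le_rfl).dvd
  obtain ⟨b, hb⟩ := (leaper_reflect s (m + 1) m (by lia)).dvd
  rw [show m + 1 - (m + 1) = 0 by lia, show m + 1 + (m + 1) = 2 * m + 1 + 1 by lia] at ha
  rw [show m + 1 - m = 1 by lia, show m + 1 + m = 2 * m + 1 by lia] at hb
  have h₀ : leaper s (-1) (0 + (2 * (m + 1) + 1)) ≡ -leaper s (-1) 0
      [ZMOD (2 * (m + 1) + 1 : ℕ)] := by
    rw [show 0 + (2 * (m + 1) + 1) = 2 * m + 1 + 2 by lia, leaper_add_two]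
    refine Int.modEq_iff_dvd.2 ⟨2 * s * (2 * ↑(2 * m + 1) + 3) * a + b - 4 * s, ?_⟩
    simp only [leaper] at *
    push_cast at *
    linear_combination 2 * s * (2 * (2 * m + 1) + 3) * ha + hb
  induction j using Nat.twoStepInduction with
  | zero => exact h₀
  | one =>
    obtain ⟨c, hc⟩ := h₀.dvd
    rw [show 0 + (2 * (m + 1) + 1) = 2 * m + 1 + 2 by lia] at hc
    rw [show 1 + (2 * (m + 1) + 1) = 2 * m + 1 + 1 + 2 by lia, leaper_add_two]
    refine Int.modEq_iff_dvd.2 ⟨2 * s * (2 * ↑(2 * m + 1 + 1) + 3) * c + a + 4 * s, ?_⟩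
    simp only [leaper] at ha hc ⊢
    push_cast at *
    linear_combination 2 * s * (2 * (2 * m + 1 + 1) + 3) * hc + ha
  | more j ih₀ ih₁ =>
    obtain ⟨c, hc⟩ := ih₀.dvd
    obtain ⟨d, hd⟩ := ih₁.dvd
    rw [show j + 1 + (2 * (m + 1) + 1) = j + (2 * (m + 1) + 1) + 1 by lia] at hd
    rw [show j + 2 + (2 * (m + 1) + 1) = j + (2 * (m + 1) + 1) + 2 by lia, leaper_add_two,
      leaper_add_two]
    refine Int.modEq_iff_dvd.2 ⟨2 * s * (2 * ↑(j + (2 * (m + 1) + 1)) + 3) * d + c +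
      4 * s * leaper s (-1) (j + 1), ?_⟩
    push_cast at *
    linear_combination 2 * s * (2 * (j + (2 * (m + 1) + 1)) + 3) * hd + hc

theorem dvd_leaper_of_modEq (s : ℕ) {n : ℕ} (hn : Odd n) (hn1 : n ≠ 1) {i j : ℕ}
    (hij : i ≡ j [MOD n]) (h : (n : ℤ) ∣ leaper s (-1) i) : (n : ℤ) ∣ leaper s (-1) j := by
  have key (i k : ℕ) : (n : ℤ) ∣ leaper s (-1) (i + n * k) ↔ (n : ℤ) ∣ leaper s (-1) i := by
    induction k with
    | zero => rfl
    | succ k ih =>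
      rw [← ih, Nat.mul_succ, ← add_assoc, (leaper_add_modEq s hn hn1 _).dvd_iff, dvd_neg]
  rw [← Nat.mod_add_div i n, key] at h
  rwa [← Nat.mod_add_div j n, key, ← hij]

/-- The remainder `± (Qⱼe^{1/s} - Pⱼ)` of a leaper, up to a power of `s`, as an integral. -/
noncomputable def leaperIntegral (c : ℝ) (j : ℕ) : ℝ :=
  ∫ t in (0 : ℝ)..1, (t * (1 - t)) ^ j / j.factorial * Real.exp (c * t)

theorem leaperIntegral_pos (c : ℝ) (j : ℕ) : 0 < leaperIntegral c j := by
  refine intervalIntegral.intervalIntegral_pos_of_pos_on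
    (Continuous.intervalIntegrable (by fun_prop) _ _) (fun t ht => ?_) one_pos
  have := mul_pos ht.1 (sub_pos.2 ht.2)
  positivity

theorem mul_leaperIntegral_zero (c : ℝ) : c * leaperIntegral c 0 = Real.exp c - 1 := by
  have h : ∀ t ∈ Set.uIcc (0 : ℝ) 1, HasDerivAt (fun t => Real.exp (c * t))
      (c * ((t * (1 - t)) ^ 0 / Nat.factorial 0 * Real.exp (c * t))) t := fun t _ => by
    refine ((hasDerivAt_id' t).const_mul c).exp.congr_deriv ?_
    simp; ring
  rw [leaperIntegral, ← intervalIntegral.integral_const_mul,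
    intervalIntegral.integral_eq_sub_of_hasDerivAt h
      (Continuous.intervalIntegrable (by fun_prop) _ _)]
  simp

theorem hasDerivAt_exp_mul_sub {f f' : ℝ → ℝ} {f'' c t : ℝ} (hf : HasDerivAt f (f' t) t)
    (hf' : HasDerivAt f' f'' t) :
    HasDerivAt (fun t => Real.exp (c * t) * (f' t - c * f t))
      ((f'' - c ^ 2 * f t) * Real.exp (c * t)) t := by
  refine (((hasDerivAt_id' t).const_mul c).exp.mul (hf'.sub (hf.const_mul c))).congr_deriv ?_
  simp only [Pi.sub_apply]
  ring

theorem hasDerivAt_mul_one_sub (t : ℝ) : HasDerivAt (fun t : ℝ => t * (1 - t)) (1 - 2 * t) t := by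
  refine ((hasDerivAt_id' t).mul ((hasDerivAt_id' t).const_sub 1)).congr_deriv ?_
  ring

theorem leaperIntegral_one (c : ℝ) :
    c ^ 2 * leaperIntegral c 1 = Real.exp c + 1 - 2 * leaperIntegral c 0 := by
  have h : ∀ t ∈ Set.uIcc (0 : ℝ) 1, HasDerivAt
      (fun t => Real.exp (c * t) * ((1 - 2 * t) - c * (t * (1 - t))))
      ((-2 - c ^ 2 * (t * (1 - t))) * Real.exp (c * t)) t := fun t _ => by
    refine hasDerivAt_exp_mul_sub (f := fun t => t * (1 - t)) (f' := fun t => 1 - 2 * t)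
      (hasDerivAt_mul_one_sub t) ?_
    exact (((hasDerivAt_id' t).const_mul 2).const_sub 1).congr_deriv (by norm_num)
  have := intervalIntegral.integral_eq_sub_of_hasDerivAt h
    (Continuous.intervalIntegrable (by fun_prop) _ _)
  have h₂ : (∫ t in (0 : ℝ)..1, (-2 - c ^ 2 * (t * (1 - t))) * Real.exp (c * t)) =
      -2 * leaperIntegral c 0 - c ^ 2 * leaperIntegral c 1 := by
    rw [leaperIntegral, leaperIntegral, ← intervalIntegral.integral_const_mul,
      ← intervalIntegral.integral_const_mul, ← intervalIntegral.integral_sub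
        (Continuous.intervalIntegrable (by fun_prop) _ _)
        (Continuous.intervalIntegrable (by fun_prop) _ _)]
    congr 1 with t
    simp; ring
  rw [h₂] at this
  norm_num at this
  linarith

theorem leaperIntegral_add_two (c : ℝ) (j : ℕ) :
    c ^ 2 * leaperIntegral c (j + 2) =
      leaperIntegral c j - (4 * j + 6) * leaperIntegral c (j + 1) := by
  have h : ∀ t ∈ Set.uIcc (0 : ℝ) 1, HasDerivAt
      (fun t => Real.exp (c * t) * ((t * (1 - t)) ^ (j + 1) / (j + 1).factorial * (1 - 2 * t) -
        c * ((t * (1 - t)) ^ (j + 2) / (j + 2).factorial)))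
      (((t * (1 - t)) ^ j / j.factorial - (4 * j + 6) * ((t * (1 - t)) ^ (j + 1) /
        (j + 1).factorial) - c ^ 2 * ((t * (1 - t)) ^ (j + 2) / (j + 2).factorial)) *
          Real.exp (c * t)) t := fun t _ => by
    have hu := hasDerivAt_mul_one_sub t
    refine hasDerivAt_exp_mul_sub (f := fun t => (t * (1 - t)) ^ (j + 2) / (j + 2).factorial)
      (f' := fun t => (t * (1 - t)) ^ (j + 1) / (j + 1).factorial * (1 - 2 * t)) ?_ ?_
    · refine ((hu.pow (j + 2)).div_const _).congr_deriv ?_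
      simp only [Nat.factorial_succ (j + 1), Nat.add_succ_sub_one]
      push_cast
      field_simp
      ring
    · refine (((hu.pow (j + 1)).div_const _).mul
        (((hasDerivAt_id' t).const_mul 2).const_sub 1)).congr_deriv ?_
      simp only [Nat.factorial_succ j, Nat.add_succ_sub_one, Pi.pow_apply]
      push_cast
      field_simp
      ring
  have := intervalIntegral.integral_eq_sub_of_hasDerivAt h
    (Continuous.intervalIntegrable (by fun_prop) _ _)
  have h₂ : (∫ t in (0 : ℝ)..1, ((t * (1 - t)) ^ j / j.factorial - (4 * j + 6) *
      ((t * (1 - t)) ^ (j + 1) / (j + 1).factorial) -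
        c ^ 2 * ((t * (1 - t)) ^ (j + 2) / (j + 2).factorial)) * Real.exp (c * t)) =
      leaperIntegral c j - (4 * j + 6) * leaperIntegral c (j + 1) -
        c ^ 2 * leaperIntegral c (j + 2) := by
    rw [leaperIntegral, leaperIntegral, leaperIntegral, ← intervalIntegral.integral_const_mul,
      ← intervalIntegral.integral_const_mul, ← intervalIntegral.integral_sub
        (Continuous.intervalIntegrable (by fun_prop) _ _)
        (Continuous.intervalIntegrable (by fun_prop) _ _), ← intervalIntegral.integral_sub
        (Continuous.intervalIntegrable (by fun_prop) _ _)
        (Continuous.intervalIntegrable (by fun_prop) _ _)]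
    congr 1 with t
    ring
  rw [h₂] at this
  norm_num at this
  linarith

/-- The absolute value of `Qⱼe^{1/s} - Pⱼ`. -/
noncomputable def leaperRem (s j : ℕ) : ℝ :=
  (-1) ^ j * (leaper s (-1) j * Real.exp (1 / s) - leaper s 1 j)

theorem leaperRem_eq {s : ℕ} (hs : 1 ≤ s) (j : ℕ) :
    leaperRem s j = (1 / s) ^ (j + 1) * leaperIntegral (1 / s) j := by
  have hsc : (1 / s : ℝ) * s = 1 := one_div_mul_cancel (by positivity)
  have h₀ := mul_leaperIntegral_zero (1 / s)
  have h₁ := leaperIntegral_one (1 / s)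
  induction j using Nat.twoStepInduction with
  | zero => simp only [leaperRem, leaper]; push_cast; linarith
  | one =>
    simp only [leaperRem, leaper]
    push_cast
    linear_combination -h₁ + 2 * s * h₀ - 2 * leaperIntegral (1 / s) 0 * hsc
  | more j ih₀ ih₁ =>
    have h : leaperRem s (j + 2) = leaperRem s j - 2 * s * (2 * j + 3) * leaperRem s (j + 1) := by
      simp only [leaperRem, leaper_add_two]
      push_cast
      ring
    have h₂ := leaperIntegral_add_two (1 / s) j
    rw [h, ih₀, ih₁, show j + 2 + 1 = j + 1 + 2 by lia, pow_add _ (j + 1) 2,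
      mul_assoc (_ ^ (j + 1)), h₂]
    linear_combination -(4 * j + 6) * (1 / s) ^ (j + 1) * leaperIntegral (1 / s) (j + 1) * hsc

theorem leaperRem_pos {s : ℕ} (hs : 1 ≤ s) (j : ℕ) : 0 < leaperRem s j := by
  rw [leaperRem_eq hs]
  have := leaperIntegral_pos (1 / s) j
  positivity

theorem abs_leaper_mul_exp_sub {s : ℕ} (hs : 1 ≤ s) (j : ℕ) :
    |leaper s (-1) j * Real.exp (1 / s) - leaper s 1 j| = leaperRem s j := by
  rw [← abs_of_pos (leaperRem_pos hs j), leaperRem, abs_mul]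
  simp

theorem leaperRem_mul_add (s j : ℕ) :
    leaperRem s j * leaper s (-1) (j + 1) + leaperRem s (j + 1) * leaper s (-1) j = 2 := by
  have h := congrArg (Int.cast : ℤ → ℝ) (leaper_det s j)
  have h₁ : ((-1 : ℝ) ^ j) * (-1) ^ j = 1 := by rw [← mul_pow]; simp
  push_cast at h
  simp only [leaperRem, pow_succ]
  linear_combination (-1) ^ j * h + 2 * h₁

theorem leaperRem_mul_lt {s : ℕ} (hs : 1 ≤ s) (j : ℕ) :
    leaperRem s j * leaper s (-1) (j + 1) < 2 := by
  have h₀ : (1 : ℝ) ≤ leaper s (-1) j := by exact_mod_cast one_le_leaper hs j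
  have h₁ := mul_pos (leaperRem_pos hs (j + 1)) (one_pos.trans_le h₀)
  linarith [leaperRem_mul_add s j]

theorem leaper_mul_leaperRem_le {s : ℕ} (hs : 1 ≤ s) (j : ℕ) :
    leaper s (-1) j * leaperRem s j ≤ 2 / (2 * j + 1) := by
  have h : ((2 * j + 1) * leaper s (-1) j : ℝ) ≤ leaper s (-1) (j + 1) := by
    exact_mod_cast leaper_mul_le hs j
  rw [le_div_iff₀ (by positivity)]
  nlinarith [leaperRem_mul_lt hs j, leaperRem_pos hs j]

theorem leaperRem_succ_le {s : ℕ} (hs : 1 ≤ s) (j : ℕ) :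
    leaperRem s (j + 1) ≤ leaperRem s j := by
  have h₀ : (1 : ℝ) ≤ s := by exact_mod_cast hs
  have h₂ := leaperRem_pos hs (j + 2)
  have h : leaperRem s (j + 2) = leaperRem s j - 2 * s * (2 * j + 3) * leaperRem s (j + 1) := by
    simp only [leaperRem, leaper_add_two]
    push_cast
    ring
  have h₃ : 1 ≤ 2 * (s : ℝ) * (2 * j + 3) := by nlinarith [j.cast_nonneg (α := ℝ)]
  nlinarith [leaperRem_pos hs (j + 1)]

/-- A sufficiently good rational approximation of `e^{1/s}` is a leaper. -/
theorem exists_leaper_of_approx {s : ℕ} (hs : 1 ≤ s) {P Q : ℤ} (hQ : Q ≠ 0)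
    (h : |(Q : ℝ)| * |Q * Real.exp (1 / s) - P| ≤ 1 / 8) :
    ∃ j, P * leaper s (-1) j = Q * leaper s 1 j := by
  have hQ₁ : (1 : ℝ) ≤ |(Q : ℝ)| := by exact_mod_cast Int.one_le_abs hQ
  have hex : ∃ j, 4 * |Q| ≤ leaper s (-1) (j + 1) :=
    ⟨(4 * |Q|).toNat, (Int.self_le_toNat _).trans (le_leaper_succ hs _)⟩
  classical
  obtain ⟨j, hj, hmin⟩ : ∃ j, 4 * |Q| ≤ leaper s (-1) (j + 1) ∧ leaper s (-1) j < 4 * |Q| := by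
    refine ⟨Nat.find hex, Nat.find_spec hex, ?_⟩
    rcases hk : Nat.find hex with _ | k
    · simp only [leaper]
      linarith [Int.one_le_abs hQ]
    · exact not_le.1 (Nat.find_min hex (by lia : k < Nat.find hex))
  refine ⟨j, sub_eq_zero.1 (Int.abs_lt_one_iff.1 ?_)⟩
  have hj' : 4 * |(Q : ℝ)| ≤ leaper s (-1) (j + 1) := by exact_mod_cast hj
  have hmin' : (leaper s (-1) j : ℝ) < 4 * |(Q : ℝ)| := by exact_mod_cast hmin
  have h₀ : (1 : ℝ) ≤ leaper s (-1) j := by exact_mod_cast one_le_leaper hs j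
  have hr := leaperRem_pos hs j
  have hlt := leaperRem_mul_lt hs j
  have hD : |((P * leaper s (-1) j - Q * leaper s 1 j : ℤ) : ℝ)| ≤
      |(Q : ℝ)| * leaperRem s j + leaper s (-1) j * |Q * Real.exp (1 / s) - P| := by
    rw [← abs_leaper_mul_exp_sub hs j, ← abs_mul,
      ← abs_of_pos (one_pos.trans_le h₀), ← abs_mul, abs_of_pos (one_pos.trans_le h₀)]
    refine le_trans (le_of_eq ?_) (abs_sub _ _)
    congr 1
    push_cast
    ring
  have h₁ : |(Q : ℝ)| * leaperRem s j < 1 / 2 := by nlinarith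
  have h₂ : leaper s (-1) j * |Q * Real.exp (1 / s) - P| ≤ 1 / 2 := by
    nlinarith [abs_nonneg (Q * Real.exp (1 / s) - P)]
  exact_mod_cast hD.trans_lt (by linarith : _ < (1 : ℝ))

theorem distNearestInt_le (x : ℝ) (m : ℤ) : distNearestInt x ≤ |x - m| := round_le x m

theorem distNearestInt_nonneg (x : ℝ) : 0 ≤ distNearestInt x := abs_nonneg _

theorem abs_mul_abs_sub_one_div {n : ℕ} (hn : n ≠ 0) (θ : ℝ) (p q : ℤ) :
    |(q : ℝ)| * |q * θ - 1 / n - p| =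
      |((n * q : ℤ) : ℝ)| * |(n * q : ℤ) * θ - (n * p + 1 : ℤ)| / n ^ 2 := by
  have : ((n * q : ℤ) : ℝ) * θ - (n * p + 1 : ℤ) = n * (q * θ - 1 / n - p) := by
    push_cast
    field_simp
    ring
  rw [this, abs_mul]
  push_cast
  rw [abs_mul, Nat.abs_cast]
  field_simp

theorem frequently_cofinite_of_forall_exists_lt {p : ℤ → Prop} (h : ∀ N : ℕ, ∃ q > (N : ℤ), p q) :
    ∃ᶠ q in Filter.cofinite, p q := by
  rw [Int.cofinite_eq, Filter.frequently_sup]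
  refine Or.inr (Filter.frequently_atTop.2 fun a => ?_)
  obtain ⟨q, hq, hp⟩ := h a.toNat
  exact ⟨q, by lia, hp⟩

theorem exists_modEq_mem_Ioc {n : ℕ} (hn : n ≠ 0) (x : ℤ) :
    ∃ y : ℤ, 1 ≤ y ∧ y ≤ n ∧ (n : ℤ) ∣ y - x := by
  have hn' : (0 : ℤ) < n := by lia
  refine ⟨(x - 1) % n + 1, ?_, ?_, ?_⟩
  · linarith [Int.emod_nonneg (x - 1) hn'.ne']
  · linarith [Int.emod_lt_of_pos (x - 1) hn']
  · exact ⟨-((x - 1) / n), by linarith [Int.emod_add_mul_ediv (x - 1) n]⟩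

theorem frequently_le_eight {s n : ℕ} (hs : 1 ≤ s) (hn : n ≠ 0) :
    ∃ᶠ q : ℤ in Filter.cofinite,
      |(q : ℝ)| * distNearestInt (q * Real.exp (1 / s) - 1 / n) ≤ 8 := by
  refine frequently_cofinite_of_forall_exists_lt fun N => ?_
  set j := 2 * n * (N + 1) with hj
  obtain ⟨x, hx₁, hxn, a, ha⟩ := exists_modEq_mem_Ioc (n := 2 * n) (by lia)
    (-(-1) ^ j * leaper s (-1) (j + 1))
  obtain ⟨y, hy₁, hyn, b, hb⟩ := exists_modEq_mem_Ioc (n := 2 * n) (by lia)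
    ((-1) ^ j * leaper s (-1) j)
  have hdet := leaper_det s j
  have hsq : ((-1 : ℤ) ^ j) * (-1) ^ j = 1 := by rw [← mul_pow]; simp
  set p := a * leaper s 1 j + b * leaper s 1 (j + 1) with hp
  set q := a * leaper s (-1) j + b * leaper s (-1) (j + 1) with hq
  push_cast at ha hb hxn hyn
  have hP : 2 * (n * p + 1) = x * leaper s 1 j + y * leaper s 1 (j + 1) := by
    linear_combination -leaper s 1 j * ha - leaper s 1 (j + 1) * hb - (-1) ^ j * hdet - 2 * hsq +
      2 * n * hp
  have hQ : 2 * (n * q) = x * leaper s (-1) j + y * leaper s (-1) (j + 1) := by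
    linear_combination -leaper s (-1) j * ha - leaper s (-1) (j + 1) * hb + 2 * n * hq
  have h₀ := one_le_leaper hs j
  have h₁ := leaper_le_succ hs j
  have hn₀ : (1 : ℤ) ≤ n := by lia
  have hlarge : (N : ℤ) < q := by
    have := le_leaper_succ hs j
    have hj' : (j : ℤ) = 2 * n * (N + 1) := by rw [hj]; push_cast; ring
    have : 2 * n * (N + 1) ≤ 2 * n * q := by nlinarith
    have := le_of_mul_le_mul_left this (by linarith)
    linarith
  refine ⟨q, hlarge, ?_⟩
  refine (mul_le_mul_of_nonneg_left (distNearestInt_le _ p) (abs_nonneg _)).trans ?_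
  rw [abs_mul_abs_sub_one_div hn, div_le_iff₀ (by positivity)]
  have hQle : ((n * q : ℤ) : ℝ) ≤ 2 * n * leaper s (-1) (j + 1) := by
    have : n * q ≤ 2 * n * leaper s (-1) (j + 1) := by nlinarith
    exact_mod_cast this
  have hQpos : (0 : ℝ) ≤ ((n * q : ℤ) : ℝ) := by
    have : (0 : ℤ) ≤ n * q := mul_nonneg (by lia) (by lia)
    exact_mod_cast this
  have hR : |((n * q : ℤ) : ℝ) * Real.exp (1 / s) - (n * p + 1 : ℤ)| ≤ 2 * n * leaperRem s j := by
    have hQ' : 2 * ((n * q : ℤ) : ℝ) = x * leaper s (-1) j + y * leaper s (-1) (j + 1) := by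
      exact_mod_cast hQ
    have hP' : 2 * ((n * p + 1 : ℤ) : ℝ) = x * leaper s 1 j + y * leaper s 1 (j + 1) := by
      exact_mod_cast hP
    have hx₀ : (0 : ℝ) ≤ x := by exact_mod_cast (by lia : 0 ≤ x)
    have hy₀ : (0 : ℝ) ≤ y := by exact_mod_cast (by lia : 0 ≤ y)
    have hxn' : (x : ℝ) ≤ 2 * n := by exact_mod_cast hxn
    have hyn' : (y : ℝ) ≤ 2 * n := by exact_mod_cast hyn
    have hle := leaperRem_succ_le hs j
    have hpos := leaperRem_pos hs j
    have hpos₁ := leaperRem_pos hs (j + 1)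
    have : 2 * |((n * q : ℤ) : ℝ) * Real.exp (1 / s) - (n * p + 1 : ℤ)| ≤
        x * leaperRem s j + y * leaperRem s (j + 1) := by
      rw [← abs_leaper_mul_exp_sub hs, ← abs_leaper_mul_exp_sub hs]
      nth_rw 1 [← abs_of_nonneg hx₀, ← abs_of_nonneg hy₀, ← abs_two (α := ℝ)]
      rw [← abs_mul, ← abs_mul, ← abs_mul]
      refine le_trans (le_of_eq ?_) (abs_add_le _ _)
      congr 1
      linear_combination Real.exp (1 / s) * hQ' - hP'
    nlinarith
  rw [abs_of_nonneg hQpos]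
  have hbound := hQpos.trans hQle
  calc _ ≤ (2 * n * leaper s (-1) (j + 1)) * (2 * n * leaperRem s j) := by gcongr
    _ = 4 * n ^ 2 * (leaperRem s j * leaper s (-1) (j + 1)) := by ring
    _ ≤ 4 * n ^ 2 * 2 := by have := leaperRem_mul_lt hs j; gcongr
    _ = 8 * n ^ 2 := by ring

theorem Lconst_exp_eq_zero_iff_frequently {s n : ℕ} (hs : 1 ≤ s) (hn : n ≠ 0) :
    Lconst (Real.exp (1 / s)) (1 / n) = 0 ↔ ∀ ε > 0, ∃ᶠ q : ℤ in Filter.cofinite,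
      |(q : ℝ)| * distNearestInt (q * Real.exp (1 / s) - 1 / n) ≤ ε := by
  have hnonneg (q : ℤ) : 0 ≤ |(q : ℝ)| * distNearestInt (q * Real.exp (1 / s) - 1 / n) :=
    mul_nonneg (abs_nonneg _) (distNearestInt_nonneg _)
  have hcob : Filter.IsCoboundedUnder (· ≥ ·) Filter.cofinite
      (fun q : ℤ => |(q : ℝ)| * distNearestInt (q * Real.exp (1 / s) - 1 / n)) :=
    Filter.IsCoboundedUnder.of_frequently_le (frequently_le_eight hs hn)
  have hbdd : Filter.IsBoundedUnder (· ≥ ·) Filter.cofinite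
      (fun q : ℤ => |(q : ℝ)| * distNearestInt (q * Real.exp (1 / s) - 1 / n)) :=
    Filter.isBoundedUnder_of ⟨0, hnonneg⟩
  constructor
  · intro h ε hε
    exact (Filter.frequently_lt_of_liminf_lt hcob (h.trans_lt hε)).mono fun _ => le_of_lt
  · intro h
    refine le_antisymm (le_of_forall_pos_le_add fun ε hε => ?_) ?_
    · rw [zero_add]
      exact Filter.liminf_le_of_frequently_le (h ε hε) hbdd
    · exact Filter.le_liminf_of_le hcob (Filter.Eventually.of_forall hnonneg)

theorem exists_dvd_leaper {s n : ℕ} (hs : 1 ≤ s) (hn : n ≠ 0)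
    (h : Lconst (Real.exp (1 / s)) (1 / n) = 0) : ∃ j, (n : ℤ) ∣ leaper s (-1) j := by
  have hfreq := (Lconst_exp_eq_zero_iff_frequently hs hn).1 h (1 / 8 / n ^ 2) (by positivity)
  obtain ⟨q, hq, hq₀⟩ := (hfreq.and_eventually
    (Filter.eventually_cofinite_ne (0 : ℤ))).exists
  rw [distNearestInt, abs_mul_abs_sub_one_div hn, div_le_div_iff_of_pos_right (by positivity)] at hq
  obtain ⟨j, hj⟩ := exists_leaper_of_approx hs (mul_ne_zero (by exact_mod_cast hn) hq₀) hq
  refine ⟨j, q * leaper s 1 j -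
    round (q * Real.exp (1 / s) - 1 / n) * leaper s (-1) j, ?_⟩
  linear_combination hj

theorem isCoprime_leaper (s j : ℕ) : IsCoprime (leaper s 1 j) (leaper s (-1) j) := by
  obtain ⟨k, hk⟩ := odd_leaper s (a := -1) (by decide) j
  have hdet := leaper_det s j
  have hsq : ((-1 : ℤ) ^ j) * (-1) ^ j = 1 := by rw [← mul_pow]; simp
  refine ⟨k * (-1) ^ j * leaper s (-1) (j + 1), 1 - k * (-1) ^ j * leaper s 1 (j + 1), ?_⟩
  linear_combination -k * (-1) ^ j * hdet - 2 * k * hsq + hk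

theorem Lconst_exp_eq_zero_of_dvd {s n : ℕ} (hs : 1 ≤ s) (hn : n ≠ 0)
    (h : ∀ N : ℕ, ∃ j ≥ N, (n : ℤ) ∣ leaper s (-1) j) :
    Lconst (Real.exp (1 / s)) (1 / n) = 0 := by
  rw [Lconst_exp_eq_zero_iff_frequently hs hn]
  refine fun ε hε => frequently_cofinite_of_forall_exists_lt fun N => ?_
  obtain ⟨M, hM⟩ := exists_nat_gt (2 / ε)
  obtain ⟨j, hj, c, hc⟩ := h (M + n * (N + 1) + 1)
  obtain ⟨i, rfl⟩ : ∃ i, j = i + 1 := ⟨j - 1, by lia⟩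
  obtain ⟨u, v, huv⟩ := isCoprime_leaper s (i + 1)
  obtain ⟨m, hm₁, hmn, b, hb⟩ := exists_modEq_mem_Ioc hn u
  have hn₀ : (1 : ℤ) ≤ n := by lia
  have hQ : n * (m * c) = m * leaper s (-1) (i + 1) := by rw [hc]; ring
  have hP : n * (b * leaper s 1 (i + 1) - v * c) + 1 = m * leaper s 1 (i + 1) := by
    linear_combination -leaper s 1 (i + 1) * hb - huv + v * hc
  have h₁ := one_le_leaper hs (i + 1)
  refine ⟨m * c, ?_, ?_⟩
  · have hi := le_leaper_succ hs i
    have hi' : (n * (N + 1) : ℤ) ≤ i := by exact_mod_cast (by lia : n * (N + 1) ≤ i)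
    have : n * (N + 1) ≤ n * (m * c) := by nlinarith
    have := le_of_mul_le_mul_left this (by linarith)
    linarith
  · refine (mul_le_mul_of_nonneg_left (distNearestInt_le _ (b * leaper s 1 (i + 1) - v * c))
      (abs_nonneg _)).trans ?_
    rw [abs_mul_abs_sub_one_div hn, hQ, hP, div_le_iff₀ (by positivity)]
    have hm₀ : (0 : ℝ) ≤ m := by exact_mod_cast (by lia : 0 ≤ m)
    have hmn' : (m : ℝ) ≤ n := by exact_mod_cast hmn
    have h₁' : (0 : ℝ) ≤ leaper s (-1) (i + 1) := by exact_mod_cast (by lia)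
    have hj' : (M : ℝ) ≤ (i + 1 : ℕ) := by exact_mod_cast (by lia)
    have hsmall : leaper s (-1) (i + 1) * leaperRem s (i + 1) ≤ ε := by
      refine (leaper_mul_leaperRem_le hs (i + 1)).trans ?_
      rw [div_lt_iff₀ hε] at hM
      rw [div_le_iff₀ (by positivity)]
      nlinarith
    have heq : ((m * leaper s (-1) (i + 1) : ℤ) : ℝ) * Real.exp (1 / s) -
        (m * leaper s 1 (i + 1) : ℤ) =
          m * (leaper s (-1) (i + 1) * Real.exp (1 / s) - leaper s 1 (i + 1)) := by
      push_cast
      ring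
    rw [heq, abs_mul, abs_leaper_mul_exp_sub hs]
    push_cast
    rw [abs_mul, abs_of_nonneg hm₀, abs_of_nonneg h₁']
    calc _ = m ^ 2 * (leaper s (-1) (i + 1) * leaperRem s (i + 1)) := by ring
      _ ≤ n ^ 2 * ε := by
        have := leaperRem_pos hs (i + 1)
        gcongr
      _ = ε * n ^ 2 := mul_comm _ _

theorem odd_of_dvd_leaper {s n j : ℕ} (h : (n : ℤ) ∣ leaper s (-1) j) : Odd n := by
  obtain ⟨c, hc⟩ := h
  have := odd_leaper s (a := -1) (by decide) j
  rw [hc, Int.odd_mul] at this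
  exact_mod_cast this.1

/-- Let `s ≥ 1`. If `n₁, n₂ ≥ 2` are relatively prime integers with
`L(e^{1/s}, 1/n₁) = 0 = L(e^{1/s}, 1/n₂)`, then `L(e^{1/s}, 1/(n₁n₂)) = 0`. -/
theorem Lconst_exp_zero_mul (s n₁ n₂ : ℕ) (hs : 1 ≤ s)
    (hn₁ : 2 ≤ n₁) (hn₂ : 2 ≤ n₂) (hcop : Nat.Coprime n₁ n₂)
    (h₁ : Lconst (Real.exp (1 / s)) (1 / n₁) = 0)
    (h₂ : Lconst (Real.exp (1 / s)) (1 / n₂) = 0) :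
    Lconst (Real.exp (1 / s)) (1 / (n₁ * n₂ : ℕ)) = 0 := by
  obtain ⟨j₁, hj₁⟩ := exists_dvd_leaper hs (by lia) h₁
  obtain ⟨j₂, hj₂⟩ := exists_dvd_leaper hs (by lia) h₂
  have hne : n₁ * n₂ ≠ 0 := mul_ne_zero (by lia) (by lia)
  refine Lconst_exp_eq_zero_of_dvd hs hne fun N => ?_
  obtain ⟨k, hk₁, hk₂⟩ := Nat.chineseRemainder hcop j₁ j₂
  refine ⟨k + n₁ * n₂ * N, ?_, ?_⟩
  · have := Nat.le_mul_of_pos_left N (Nat.pos_of_ne_zero hne)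
    lia
  · push_cast
    refine (Nat.isCoprime_iff_coprime.2 hcop).mul_dvd
      (dvd_leaper_of_modEq s (odd_of_dvd_leaper hj₁) (by lia) ?_ hj₁)
      (dvd_leaper_of_modEq s (odd_of_dvd_leaper hj₂) (by lia) ?_ hj₂)
    · rw [mul_assoc]
      exact hk₁.symm.trans (by simp [Nat.ModEq])
    · rw [mul_comm n₁, mul_assoc]
      exact hk₂.symm.trans (by simp [Nat.ModEq])
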